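/- arXiv:2404.09396 — 4 statements merged into one kernel-verified Lean document; each statement's English description precedes it below -/
import Mathlib

section
/- Let G be a cograph having exactly k main Q-eigenvalues, where k ≥ 2, and let c ≥ 1 be an integer. Then the join K_c ⊕ G has exactly k or exactly k+1 main Q-eigenvalues. -/
open SimpleGraph

/-- The signless Laplacian matrix `Q(G) = D(G) + A(G)` of a finite simple graph. -/
noncomputable def signlessLaplacian {V : Type*} [Fintype V] (G : SimpleGraph V) :
    Matrix V V ℝ :=
  letI := Classical.decEq V
  letI := Classical.decRel G.Adj
  Matrix.diagonal (fun v => (G.degree v : ℝ)) + G.adjMatrix ℝ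

/-- `q` is a main Q-eigenvalue of `G`: some eigenvector of `Q(G)` for `q`
has nonzero entry sum. -/
def IsMainQEigenvalue {V : Type*} [Fintype V] (G : SimpleGraph V) (q : ℝ) : Prop :=
  ∃ x : V → ℝ, (signlessLaplacian G).mulVec x = q • x ∧ (∑ v, x v) ≠ 0

/-- The number of (distinct) main Q-eigenvalues of `G`. -/
noncomputable def mainQCount {V : Type*} [Fintype V] (G : SimpleGraph V) : ℕ :=
  {q : ℝ | IsMainQEigenvalue G q}.ncard

/-- `G` contains an induced copy of `H`. -/
def HasInducedCopy {α β : Type*} (H : SimpleGraph α) (G : SimpleGraph β) : Prop :=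
  ∃ f : α ↪ β, ∀ a b : α, H.Adj a b ↔ G.Adj (f a) (f b)

/-- A cograph is a `P₄`-free graph. -/
def IsCograph {V : Type*} (G : SimpleGraph V) : Prop :=
  ¬ HasInducedCopy (SimpleGraph.pathGraph 4) G

/-- A quasi-threshold graph is a `{P₄, C₄}`-free graph. -/
def IsQuasiThreshold {V : Type*} (G : SimpleGraph V) : Prop :=
  ¬ HasInducedCopy (SimpleGraph.pathGraph 4) G ∧
  ¬ HasInducedCopy (SimpleGraph.cycleGraph 4) G

/-- A chordal graph: no induced cycle of length at least 4. -/
def IsChordal {V : Type*} (G : SimpleGraph V) : Prop :=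
  ∀ n : ℕ, 4 ≤ n → ¬ HasInducedCopy (SimpleGraph.cycleGraph n) G

/-- The join `G ⊕ H` of two vertex-disjoint graphs. -/
def graphJoin {V W : Type*} (G : SimpleGraph V) (H : SimpleGraph W) :
    SimpleGraph (V ⊕ W) where
  Adj x y :=
    match x, y with
    | Sum.inl a, Sum.inl b => G.Adj a b
    | Sum.inr a, Sum.inr b => H.Adj a b
    | Sum.inl _, Sum.inr _ => True
    | Sum.inr _, Sum.inl _ => True
  symm := by
    refine ⟨?_⟩
    rintro (a | a) (b | b) h
    · exact G.adj_symm h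
    · trivial
    · trivial
    · exact H.adj_symm h
  loopless := by
    refine ⟨?_⟩
    rintro (a | a) h
    · exact G.loopless.irrefl a h
    · exact H.loopless.irrefl a h

/-- The disjoint union `G ∪ H` of two vertex-disjoint graphs. -/
def disjUnionGraph {V W : Type*} (G : SimpleGraph V) (H : SimpleGraph W) :
    SimpleGraph (V ⊕ W) where
  Adj x y :=
    match x, y with
    | Sum.inl a, Sum.inl b => G.Adj a b
    | Sum.inr a, Sum.inr b => H.Adj a b
    | _, _ => False
  symm := by
    refine ⟨?_⟩
    rintro (a | a) (b | b) h
    · exact G.adj_symm h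
    · exact h.elim
    · exact h.elim
    · exact H.adj_symm h
  loopless := by
    refine ⟨?_⟩
    rintro (a | a) h
    · exact G.loopless.irrefl a h
    · exact H.loopless.irrefl a h

/-- `tK_a`: the disjoint union of `t` copies of the complete graph `K_a`. -/
def copiesComplete (t a : ℕ) : SimpleGraph (Fin t × Fin a) where
  Adj x y := x.1 = y.1 ∧ x.2 ≠ y.2
  symm := ⟨fun _ _ ⟨h1, h2⟩ => ⟨h1.symm, h2.symm⟩⟩
  loopless := ⟨fun _ ⟨_, h⟩ => h rfl⟩

/-- The disjoint union `a₁ K_{n₁} ∪ ⋯ ∪ a_p K_{n_p}`: for each `i : Fin p`,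
`a i` copies of the complete graph on `n i` vertices. Two vertices are adjacent
iff they lie in the same copy of the same complete graph and are distinct. -/
def satellites (p : ℕ) (a n : Fin p → ℕ) :
    SimpleGraph ((i : Fin p) × (Fin (a i) × Fin (n i))) where
  Adj x y := x.1 = y.1 ∧ HEq x.2.1 y.2.1 ∧ ¬ HEq x.2.2 y.2.2
  symm := ⟨fun _ _ ⟨h1, h2, h3⟩ => ⟨h1.symm, h2.symm, fun h => h3 h.symm⟩⟩
  loopless := ⟨fun _ ⟨_, _, h3⟩ => h3 HEq.rfl⟩

open Module
def mainS {E : Type*} [NormedAddCommGroup E] [InnerProductSpace ℝ E] (T : E →ₗ[ℝ] E) (u : E) : Set ℝ :=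
  {q | ∃ x, T x = q • x ∧ inner ℝ u x ≠ 0}

lemma mainS_le {E : Type*} [NormedAddCommGroup E] [InnerProductSpace ℝ E] [FiniteDimensional ℝ E]
    (T : E →ₗ[ℝ] E) (hT : T.IsSymmetric) (u : E) (W : Submodule ℝ E)
    (hW : ∀ x ∈ W, T x ∈ W) (hu : u ∈ W) : (mainS T u).ncard ≤ finrank ℝ W := by
  by_cases hf : (mainS T u).Finite
  swap
  · rw [Set.Infinite.ncard hf]; exact Nat.zero_le _
  have : Fintype (mainS T u) := hf.fintype
  have key : ∀ q : mainS T u, ∃ w : E, w ∈ W ∧ T w = q.1 • w ∧ w ≠ 0 := by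
    rintro ⟨q, x, hx, hux⟩
    obtain ⟨w, hw, w', hw', rfl⟩ := W.exists_add_mem_mem_orthogonal x
    have hTw' : T w' ∈ Wᗮ := by
      rw [Submodule.mem_orthogonal] at hw' ⊢
      intro y hy
      rw [← hT y w']
      exact hw' _ (hW y hy)
    refine ⟨w, hw, ?_, ?_⟩
    · have h1 : T w - q • w ∈ W := W.sub_mem (hW w hw) (W.smul_mem q hw)
      have h2 : T w - q • w ∈ Wᗮ := by
        have : T w - q • w = -(T w' - q • w') := by
          rw [map_add, smul_add] at hx
          rw [neg_sub, sub_eq_sub_iff_add_eq_add, hx, add_comm]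
        rw [this]
        exact Wᗮ.neg_mem (Wᗮ.sub_mem hTw' (Wᗮ.smul_mem q hw'))
      have h3 := (Submodule.mem_orthogonal W _).1 h2 _ h1
      rw [inner_self_eq_zero] at h3
      exact sub_eq_zero.1 h3
    · rintro rfl
      apply hux
      rw [zero_add]
      exact (Submodule.mem_orthogonal W _).1 hw' _ hu
  choose w hw hTw hw0 using key
  have hli : LinearIndependent ℝ w :=
    Module.End.eigenvectors_linearIndependent' T (fun q : mainS T u => q.1)
      Subtype.val_injective w (fun q => ⟨Module.End.mem_eigenspace_iff.2 (hTw q), hw0 q⟩)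
  have hli' : LinearIndependent ℝ (fun q => (⟨w q, hw q⟩ : W)) :=
    LinearIndependent.of_comp W.subtype hli
  have := hli'.fintype_card_le_finrank
  rwa [Set.ncard_eq_toFinset_card', Set.toFinset_card]

lemma mainS_exists {E : Type*} [NormedAddCommGroup E] [InnerProductSpace ℝ E] [FiniteDimensional ℝ E]
    (T : E →ₗ[ℝ] E) (hT : T.IsSymmetric) (u : E) :
    ∃ W : Submodule ℝ E, (∀ x ∈ W, T x ∈ W) ∧ u ∈ W ∧ finrank ℝ W ≤ (mainS T u).ncard := by
  classical
  let b := hT.eigenvectorBasis rfl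
  let l := hT.eigenvalues rfl
  have hb : ∀ i, T (b i) = l i • b i := fun i => hT.apply_eigenvectorBasis rfl i
  let f : ℝ → E := fun q => ∑ i with l i = q, inner ℝ (b i) u • b i
  have hTf : ∀ q, T (f q) = q • f q := by
    intro q
    simp only [f, map_sum, map_smul, Finset.smul_sum]
    refine Finset.sum_congr rfl fun i hi => ?_
    rw [hb, (Finset.mem_filter.1 hi).2, smul_comm]
  have hsum : u = ∑ q ∈ Finset.univ.image l, f q := by
    rw [Finset.sum_fiberwise_of_maps_to (fun i _ => Finset.mem_image_of_mem l (Finset.mem_univ i))]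
    exact (b.sum_repr' u).symm
  have hmain : ∀ q, f q ≠ 0 → q ∈ mainS T u := by
    intro q hq
    refine ⟨f q, hTf q, fun h => hq ?_⟩
    simp only [f, inner_sum, inner_smul_right] at h
    rw [Finset.sum_eq_zero_iff_of_nonneg] at h
    · refine Finset.sum_eq_zero fun i hi => ?_
      have := h i hi
      rw [real_inner_comm, mul_self_eq_zero] at this
      rw [real_inner_comm, this, zero_smul]
    · intro i _
      rw [real_inner_comm]; exact mul_self_nonneg _
  have hfin : (mainS T u).Finite := by
    refine (Module.End.finite_hasEigenvalue T).subset ?_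
    rintro q ⟨x, hx, hux⟩
    refine Module.End.hasEigenvalue_of_hasEigenvector (x := x) ⟨Module.End.mem_eigenspace_iff.2 hx, ?_⟩
    rintro rfl; simp at hux
  refine ⟨Submodule.span ℝ ((hfin.toFinset.image f : Finset E) : Set E), ?_, ?_, ?_⟩
  · intro x hx
    induction hx using Submodule.span_induction with
    | mem x h =>
      obtain ⟨q, hq, rfl⟩ := Finset.mem_image.1 (Finset.mem_coe.1 h)
      rw [hTf]
      exact Submodule.smul_mem _ _ (Submodule.subset_span h)
    | zero => simp
    | add x y _ _ h1 h2 => rw [map_add]; exact Submodule.add_mem _ h1 h2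
    | smul a x _ h => rw [map_smul]; exact Submodule.smul_mem _ _ h
  · have : ∑ q ∈ Finset.univ.image l, f q ∈ Submodule.span ℝ ((hfin.toFinset.image f : Finset E) : Set E) := by
      refine Submodule.sum_mem _ fun q _ => ?_
      by_cases h : f q = 0
      · rw [h]; exact Submodule.zero_mem _
      · exact Submodule.subset_span (Finset.mem_coe.2 (Finset.mem_image_of_mem f (hfin.mem_toFinset.2 (hmain q h))))
    rwa [← hsum] at this
  · refine (finrank_span_finset_le_card _).trans (Finset.card_image_le.trans ?_)
    rw [Set.ncard_eq_toFinset_card _ hfin]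

lemma sl_apply {V : Type*} [Fintype V] (G : SimpleGraph V) (x : V → ℝ) (v : V) :
    (signlessLaplacian G).mulVec x v =
      ∑ w, (open Classical in if G.Adj v w then x v + x w else 0) := by
  classical
  simp only [signlessLaplacian, Matrix.add_mulVec, Pi.add_apply, Matrix.mulVec_diagonal,
    SimpleGraph.adjMatrix_mulVec_apply]
  rw [← Finset.sum_filter, Finset.sum_add_distrib, Finset.sum_const, nsmul_eq_mul,
    ← SimpleGraph.card_neighborFinset_eq_degree, SimpleGraph.neighborFinset_eq_filter]

lemma sl_herm {V : Type*} [Fintype V] (G : SimpleGraph V) :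
    (signlessLaplacian G).IsHermitian := by
  classical
  unfold signlessLaplacian
  refine Matrix.IsHermitian.add ?_ ?_
  · simp [Matrix.isHermitian_diagonal]
  · ext i j
    simp [Matrix.conjTranspose_apply, SimpleGraph.adjMatrix_apply, SimpleGraph.adj_comm]

lemma mainQCount_eq {V : Type*} [Fintype V] [DecidableEq V] (G : SimpleGraph V) :
    mainQCount G = (mainS (Matrix.toEuclideanLin (signlessLaplacian G))
      (WithLp.toLp 2 (fun _ => (1 : ℝ)))).ncard := by
  unfold mainQCount mainS
  congr 1
  ext q
  constructor
  · rintro ⟨x, hx, h⟩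
    refine ⟨WithLp.toLp 2 x, ?_, ?_⟩
    · rw [Matrix.toLpLin_toLp, Matrix.toLin'_apply, hx]; rfl
    · simpa [PiLp.inner_apply] using h
  · rintro ⟨x, hx, h⟩
    refine ⟨WithLp.ofLp x, ?_, ?_⟩
    · have := congrArg WithLp.ofLp hx
      simpa using this
    · simpa [PiLp.inner_apply] using h

lemma count_le {V : Type*} [Fintype V] (G : SimpleGraph V) (W : Submodule ℝ (V → ℝ))
    (hW : ∀ x ∈ W, (signlessLaplacian G).mulVec x ∈ W) (h1 : (fun _ => (1:ℝ)) ∈ W) :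
    mainQCount G ≤ finrank ℝ W := by
  classical
  rw [mainQCount_eq]
  let e := (WithLp.linearEquiv 2 ℝ (V → ℝ)).symm
  rw [← LinearEquiv.finrank_map_eq e W]
  refine mainS_le _ (Matrix.isSymmetric_toEuclideanLin_iff.2 (sl_herm G)) _ _ ?_ ?_
  · rintro _ ⟨x, hx, rfl⟩
    exact ⟨_, hW x hx, rfl⟩
  · exact ⟨_, h1, rfl⟩

lemma count_ge {V : Type*} [Fintype V] (G : SimpleGraph V) :
    ∃ W : Submodule ℝ (V → ℝ), (∀ x ∈ W, (signlessLaplacian G).mulVec x ∈ W) ∧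
      (fun _ => (1:ℝ)) ∈ W ∧ finrank ℝ W ≤ mainQCount G := by
  classical
  obtain ⟨W, h1, h2, h3⟩ := mainS_exists (Matrix.toEuclideanLin (signlessLaplacian G))
    (Matrix.isSymmetric_toEuclideanLin_iff.2 (sl_herm G)) (WithLp.toLp 2 (fun _ => (1 : ℝ)))
  let e := (WithLp.linearEquiv 2 ℝ (V → ℝ))
  refine ⟨W.map e.toLinearMap, ?_, ⟨_, h2, rfl⟩, ?_⟩
  · rintro _ ⟨x, hx, rfl⟩
    exact ⟨_, h1 x hx, rfl⟩
  · rw [mainQCount_eq]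
    exact (LinearEquiv.finrank_map_eq e W).le.trans h3

lemma join_inr {V : Type*} [Fintype V] (G : SimpleGraph V) (c : ℕ) (x : Fin c ⊕ V → ℝ) (v : V) :
    (signlessLaplacian (graphJoin (⊤ : SimpleGraph (Fin c)) G)).mulVec x (Sum.inr v) =
      (signlessLaplacian G).mulVec (fun w => x (Sum.inr w)) v + c * x (Sum.inr v)
        + ∑ i, x (Sum.inl i) := by
  rw [sl_apply, sl_apply, Fintype.sum_sum_type]
  have h : ∑ i : Fin c, (x (Sum.inr v) + x (Sum.inl i)) =
      c * x (Sum.inr v) + ∑ i, x (Sum.inl i) := by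
    simp [Finset.sum_add_distrib]
  rw [add_assoc, ← h, add_comm]
  congr 1
  exact Finset.sum_congr rfl fun i _ => if_pos trivial

lemma join_inl {V : Type*} [Fintype V] (G : SimpleGraph V) (c : ℕ) (a : ℝ) (z : V → ℝ) (i : Fin c) :
    (signlessLaplacian (graphJoin (⊤ : SimpleGraph (Fin c)) G)).mulVec
      (Sum.elim (fun _ => a) z) (Sum.inl i) =
      (c - 1) * (a + a) + ∑ v, (a + z v) := by
  classical
  rw [sl_apply, Fintype.sum_sum_type]
  congr 1
  · simp only [graphJoin, SimpleGraph.top_adj, Sum.elim_inl]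
    rw [← Finset.sum_filter, Finset.sum_const, nsmul_eq_mul, Finset.filter_ne,
      Finset.card_erase_of_mem (Finset.mem_univ i), Finset.card_univ, Fintype.card_fin,
      Nat.cast_sub (by have := i.2; omega)]
    simp
  · simp [graphJoin]

theorem join_complete_cograph_main_count
    {V : Type*} [Fintype V] (G : SimpleGraph V) (hcog : IsCograph G)
    (k c : ℕ) (hk : 2 ≤ k) (hc : 1 ≤ c)
    (hmain : mainQCount G = k) :
    mainQCount (graphJoin (⊤ : SimpleGraph (Fin c)) G) = k ∨
      mainQCount (graphJoin (⊤ : SimpleGraph (Fin c)) G) = k + 1 := by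
  have hlow : k ≤ mainQCount (graphJoin (⊤ : SimpleGraph (Fin c)) G) := by
    obtain ⟨M, hM, h1, hd⟩ := count_ge (graphJoin (⊤ : SimpleGraph (Fin c)) G)
    let p : (Fin c ⊕ V → ℝ) →ₗ[ℝ] (V → ℝ) := LinearMap.funLeft ℝ ℝ Sum.inr
    rw [← hmain]
    refine (count_le G (M.map p) ?_ ⟨_, h1, rfl⟩).trans ((Submodule.finrank_map_le p M).trans hd)
    rintro _ ⟨x, hx, rfl⟩
    refine ⟨_, M.sub_mem (M.sub_mem (hM x hx) (M.smul_mem (c : ℝ) hx))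
      (M.smul_mem (∑ i, x (Sum.inl i)) h1), ?_⟩
    ext v
    simp only [p, LinearMap.funLeft_apply, Pi.sub_apply, Pi.smul_apply, smul_eq_mul, join_inr]
    have : (fun w => x (Sum.inr w)) = (LinearMap.funLeft ℝ ℝ Sum.inr) x := rfl
    rw [this]
    ring
  have hup : mainQCount (graphJoin (⊤ : SimpleGraph (Fin c)) G) ≤ k + 1 := by
    obtain ⟨M, hM, h1, hd⟩ := count_ge G
    let f : (ℝ × M) →ₗ[ℝ] (Fin c ⊕ V → ℝ) :=
      { toFun := fun y => Sum.elim (fun _ => y.1) y.2.1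
        map_add' := by rintro ⟨a, z⟩ ⟨b, w⟩; ext (i | i) <;> simp
        map_smul' := by rintro r ⟨a, z⟩; ext (i | i) <;> simp }
    have hr : finrank ℝ (LinearMap.range f) ≤ k + 1 := by
      refine (LinearMap.finrank_range_le f).trans ?_
      rw [Module.finrank_prod, Module.finrank_self]
      omega
    refine (count_le _ (LinearMap.range f) ?_ ?_).trans hr
    · rintro _ ⟨⟨a, z, hz⟩, rfl⟩
      refine ⟨((c - 1) * (a + a) + ∑ v, (a + z v),
        ⟨_, M.add_mem (M.add_mem (hM z hz) (M.smul_mem (c : ℝ) hz)) (M.smul_mem (c * a) h1)⟩), ?_⟩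
      ext (i | v)
      · exact (join_inl G c a z i).symm
      · refine Eq.trans ?_ (join_inr G c (Sum.elim (fun _ => a) z) v).symm
        simp [f]
    · refine ⟨(1, ⟨_, h1⟩), ?_⟩
      ext (i | i) <;> rfl
  omega
end

section
/- Let G be a finite connected quasi-threshold graph that is not complete. Then G is isomorphic to the join K_c ⊕ H for some integer c ≥ 1 and some disconnected quasi-threshold graph H. -/
open SimpleGraph

theorem qt_exists_universal {V : Type*} [Finite V] (G : SimpleGraph V)
    (hqt : IsQuasiThreshold G) (hconn : G.Connected) :
    ∃ v : V, ∀ w, w ≠ v → G.Adj v w := by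
  classical
  have := Fintype.ofFinite V
  have := hconn.nonempty
  obtain ⟨v, hv⟩ := Finite.exists_max (fun v : V => G.degree v)
  refine ⟨v, ?_⟩
  by_contra! hne
  obtain ⟨z, hzv, hz⟩ := hne
  have key : ∃ u w, G.Adj v u ∧ G.Adj u w ∧ w ≠ v ∧ ¬ G.Adj v w := by
    by_contra! hcl
    have hall : ∀ a b (p : G.Walk a b), (a = v ∨ G.Adj v a) → (b = v ∨ G.Adj v b) := by
      intro a b p
      induction p with
      | nil => exact id
      | @cons a c d h p ih =>
        intro ha
        apply ih
        rcases ha with rfl | ha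
        · exact Or.inr h
        · by_cases hc : c = v
          · exact Or.inl hc
          · exact Or.inr (hcl a c ha h hc)
    obtain ⟨p⟩ := hconn.preconnected v z
    rcases hall v z p (Or.inl rfl) with h | h
    · exact hzv h
    · exact hz h
  obtain ⟨u, w, hvu, huw, hwv, hvw⟩ := key
  have hx : ∃ x, G.Adj v x ∧ x ≠ u ∧ ¬ G.Adj u x := by
    by_contra! hcl
    have hsub : insert w (insert v ((G.neighborFinset v).erase u)) ⊆ G.neighborFinset u := by
      intro y hy
      simp only [Finset.mem_insert, Finset.mem_erase, mem_neighborFinset] at hy ⊢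
      rcases hy with rfl | rfl | ⟨h1, h2⟩
      · exact huw
      · exact hvu.symm
      · exact hcl y h2 h1
    have h1 := Finset.card_le_card hsub
    rw [Finset.card_insert_of_notMem (by simp [hwv, hvw]),
      Finset.card_insert_of_notMem (by simp),
      Finset.card_erase_of_mem (by simpa using hvu)] at h1
    have h2 := hv u
    have h3 : 0 < (G.neighborFinset v).card := Finset.card_pos.2 ⟨u, by simpa using hvu⟩
    simp only [← card_neighborFinset_eq_degree] at h2
    omega
  obtain ⟨x, hvx, hxu, hux⟩ := hx
  have n1 : x ≠ v := hvx.ne'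
  have n2 : v ≠ u := hvu.ne
  have n3 : u ≠ w := huw.ne
  have n4 : x ≠ w := by rintro rfl; exact hvw hvx
  have hinj : Function.Injective ![x, v, u, w] := by
    intro a b
    fin_cases a <;> fin_cases b <;> simp [n1, n2, n3, n4, hxu, hwv, n1.symm, n2.symm, n3.symm, n4.symm, hxu.symm, hwv.symm]
  have hxu' : ¬ G.Adj x u := fun h => hux h.symm
  have hwv' : ¬ G.Adj w v := fun h => hvw h.symm
  by_cases hxw : G.Adj x w
  · apply hqt.2
    refine ⟨⟨_, hinj⟩, ?_⟩
    intro a b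
    fin_cases a <;> fin_cases b <;>
      simp [cycleGraph_adj, hvx, hvx.symm, hvu, hvu.symm, huw, huw.symm, hxw, hxw.symm, hux, hvw, hxu', hwv'] <;> decide
  · apply hqt.1
    have hxw' : ¬ G.Adj w x := fun h => hxw h.symm
    refine ⟨⟨_, hinj⟩, ?_⟩
    intro a b
    fin_cases a <;> fin_cases b <;>
      simp [pathGraph_adj, hvx, hvx.symm, hvu, hvu.symm, huw, huw.symm, hxw, hxw', hux, hvw, hxu', hwv']

theorem qt_comap {V W : Type*} (G : SimpleGraph V) (hqt : IsQuasiThreshold G) (f : W ↪ V) :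
    IsQuasiThreshold (G.comap f) :=
  ⟨fun ⟨g, hg⟩ => hqt.1 ⟨g.trans f, hg⟩, fun ⟨g, hg⟩ => hqt.2 ⟨g.trans f, hg⟩⟩

theorem quasiThreshold_connected_noncomplete_structure
    {V : Type*} [Fintype V] (G : SimpleGraph V)
    (hqt : IsQuasiThreshold G) (hconn : G.Connected) (hnc : G ≠ ⊤) :
    ∃ (c m : ℕ) (H : SimpleGraph (Fin m)), 1 ≤ c ∧ IsQuasiThreshold H ∧
      ¬ H.Connected ∧
      Nonempty (G ≃g graphJoin (⊤ : SimpleGraph (Fin c)) H) := by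
  classical
  let P : V → Prop := fun v => ∀ w, w ≠ v → G.Adj v w
  let e1 : {v // P v} ≃ Fin (Fintype.card {v // P v}) := Fintype.equivFin _
  let e2 : {v // ¬ P v} ≃ Fin (Fintype.card {v // ¬ P v}) := Fintype.equivFin _
  let f : Fin (Fintype.card {v // ¬ P v}) ↪ V :=
    e2.symm.toEmbedding.trans (Function.Embedding.subtype _)
  have hf : ∀ i, ¬ P (f i) := fun i => (e2.symm i).2
  have hf2 : ∀ v, ¬ P v → ∃ i, f i = v := fun v hv => ⟨e2 ⟨v, hv⟩, by simp [f]⟩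
  refine ⟨Fintype.card {v // P v}, _, G.comap f, ?_, qt_comap G hqt f, ?_, ?_⟩
  · obtain ⟨v, hv⟩ := qt_exists_universal G hqt hconn
    exact Fintype.card_pos_iff.2 ⟨⟨v, hv⟩⟩
  · intro hc
    obtain ⟨i, hi⟩ := qt_exists_universal _ (qt_comap G hqt f) hc
    apply hf i
    intro w hw
    by_cases hPw : P w
    · exact (hPw _ hw.symm).symm
    · obtain ⟨j, rfl⟩ := hf2 w hPw
      exact hi j (fun h => hw (by rw [h]))
  · let E : Fin (Fintype.card {v // P v}) ⊕ Fin (Fintype.card {v // ¬ P v}) ≃ V :=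
      (Equiv.sumCongr e1.symm e2.symm).trans (Equiv.sumCompl P)
    have hl : ∀ a, E (Sum.inl a) = (e1.symm a).1 := fun a => rfl
    have hr : ∀ a, E (Sum.inr a) = f a := fun a => rfl
    have hP : ∀ a, P (E (Sum.inl a)) := fun a => (e1.symm a).2
    refine ⟨RelIso.symm ⟨E, ?_⟩⟩
    rintro (a | a) (b | b)
    · change _ ↔ a ≠ b
      constructor
      · rintro h rfl
        exact h.ne rfl
      · intro h
        exact hP a _ (fun h' => h (Sum.inl_injective (E.injective h')).symm)
    · exact iff_of_true (hP a _ (fun h' => by simpa using E.injective h')) trivial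
    · exact iff_of_true (hP b _ (fun h' => by simpa using E.injective h')).symm trivial
    · exact Iff.rfl
end

section
/- Let G = K_{n_0} ⊕ (a_1 K_{n_1} ∪ a_2 K_{n_2} ∪ … ∪ a_p K_{n_p}) be a generalized core-satellite graph, where p, a_1, …, a_p, n_0, n_1, …, n_p ≥ 1 are integers with n_i ≠ n_j for i ≠ j, and let k ≥ 3. Then G has exactly k main Q-eigenvalues if and only if a_1 + … + a_p ≥ 3 and p = k − 1, i.e., G has at least three satellites, divided into exactly k − 1 different orders. -/
open SimpleGraph

theorem aux_mulVec {V : Type*} [Fintype V] (G : SimpleGraph V) (x : V → ℝ) (v : V)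
    [DecidableRel G.Adj] :
    (signlessLaplacian G).mulVec x v = ∑ w, if G.Adj v w then x v + x w else 0 := by
  classical
  unfold signlessLaplacian
  have h1 : ((G.degree v : ℕ) : ℝ) = ∑ w, if G.Adj v w then (1:ℝ) else 0 := by
    rw [← SimpleGraph.card_neighborFinset_eq_degree, Finset.sum_boole]
    congr 2
    ext w; simp
  have h2 : ∀ w, (if G.Adj v w then x v + x w else 0)
      = (if G.Adj v w then (1:ℝ) else 0) * x v + (if G.Adj v w then (1:ℝ) else 0) * x w := by
    intro w; split_ifs <;> ring
  simp only [h2, Finset.sum_add_distrib, ← Finset.sum_mul]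
  rw [← h1, Matrix.add_mulVec, Pi.add_apply]
  congr 1
  · rw [Matrix.mulVec_diagonal]
    congr!
  · simp only [Matrix.mulVec, dotProduct, SimpleGraph.adjMatrix_apply]
    congr!

theorem aux_sum {α : Type*} [Fintype α] [DecidableEq α] (f : α → ℝ) (c : ℝ) (v : α) (hv : f v = c) :
    ∑ w, (if v ≠ w then c + f w else 0) = Fintype.card α * c + ∑ w, f w - 2 * c := by
  have h : ∀ w, (if v ≠ w then c + f w else 0) = (c + f w) - (if v = w then c + f w else 0) := by
    intro w; by_cases h : v = w <;> simp [h]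
  simp only [h, Finset.sum_sub_distrib, Finset.sum_add_distrib]
  simp [hv]; ring

section
variable (p n₀ : ℕ) (a n : Fin p → ℕ)

theorem aux_core (x : Fin n₀ ⊕ ((i : Fin p) × (Fin (a i) × Fin (n i))) → ℝ) (v : Fin n₀) :
    (signlessLaplacian (graphJoin (⊤ : SimpleGraph (Fin n₀)) (satellites p a n))).mulVec x (Sum.inl v)
      = (n₀ + (∑ i, (a i : ℝ) * n i) - 2) * x (Sum.inl v) + ∑ w, x w := by
  classical
  rw [aux_mulVec, Fintype.sum_sum_type, Fintype.sum_sum_type]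
  have h1 : (∑ w : Fin n₀, if (graphJoin (⊤ : SimpleGraph (Fin n₀)) (satellites p a n)).Adj (Sum.inl v) (Sum.inl w)
      then x (Sum.inl v) + x (Sum.inl w) else 0) = n₀ * x (Sum.inl v) + ∑ w : Fin n₀, x (Sum.inl w) - 2 * x (Sum.inl v) := by
    have h := aux_sum (fun w : Fin n₀ => x (Sum.inl w)) (x (Sum.inl v)) v rfl
    rw [Fintype.card_fin] at h
    rw [← h]
    refine Finset.sum_congr rfl fun w _ => ?_
    congr 1
  have h2 : (∑ w, if (graphJoin (⊤ : SimpleGraph (Fin n₀)) (satellites p a n)).Adj (Sum.inl v) (Sum.inr w)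
      then x (Sum.inl v) + x (Sum.inr w) else 0) = (∑ i, (a i : ℝ) * n i) * x (Sum.inl v) + ∑ w, x (Sum.inr w) := by
    simp [graphJoin, Finset.sum_add_distrib, Fintype.card_sigma]
  rw [h1, h2]; ring

theorem aux_sat (x : Fin n₀ ⊕ ((i : Fin p) × (Fin (a i) × Fin (n i))) → ℝ) (i : Fin p)
    (s : Fin (a i)) (u : Fin (n i)) :
    (signlessLaplacian (graphJoin (⊤ : SimpleGraph (Fin n₀)) (satellites p a n))).mulVec x (Sum.inr ⟨i, s, u⟩)
      = (n₀ + n i - 2) * x (Sum.inr ⟨i, s, u⟩) + (∑ u', x (Sum.inr ⟨i, s, u'⟩)) + ∑ w, x (Sum.inl w) := by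
  classical
  rw [aux_mulVec, Fintype.sum_sum_type]
  have h1 : (∑ w : Fin n₀, if (graphJoin (⊤ : SimpleGraph (Fin n₀)) (satellites p a n)).Adj (Sum.inr ⟨i, s, u⟩) (Sum.inl w)
      then x (Sum.inr ⟨i, s, u⟩) + x (Sum.inl w) else 0) = n₀ * x (Sum.inr ⟨i, s, u⟩) + ∑ w : Fin n₀, x (Sum.inl w) := by
    simp [graphJoin, Finset.sum_add_distrib]
  have h2 : (∑ w, if (graphJoin (⊤ : SimpleGraph (Fin n₀)) (satellites p a n)).Adj (Sum.inr ⟨i, s, u⟩) (Sum.inr w)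
      then x (Sum.inr ⟨i, s, u⟩) + x (Sum.inr w) else 0) = n i * x (Sum.inr ⟨i, s, u⟩) + (∑ u', x (Sum.inr ⟨i, s, u'⟩)) - 2 * x (Sum.inr ⟨i, s, u⟩) := by
    have h := aux_sum (fun w : Fin (n i) => x (Sum.inr ⟨i, s, w⟩)) (x (Sum.inr ⟨i, s, u⟩)) u rfl
    rw [Fintype.card_fin] at h
    rw [← h]
    rw [Fintype.sum_sigma, Finset.sum_eq_single i, Fintype.sum_prod_type, Finset.sum_eq_single s]
    · refine Finset.sum_congr rfl fun w _ => ?_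
      simp [graphJoin, satellites]
    · intro s' _ hs
      simp [graphJoin, satellites, hs.symm]
    · simp
    · intro j _ hj
      simp [graphJoin, satellites, hj.symm]
    · simp
  rw [h1, h2]; ring

theorem aux_main (hn₀ : 1 ≤ n₀) (ha : ∀ i, 1 ≤ a i) (hn : ∀ i, 1 ≤ n i) (t : ℝ) :
    IsMainQEigenvalue (graphJoin (⊤ : SimpleGraph (Fin n₀)) (satellites p a n)) (t + n₀ - 2) ↔
      t ≠ (∑ i, (a i : ℝ) * n i) ∧ (∀ i, t ≠ 2 * n i) ∧
        t - ((∑ i, (a i : ℝ) * n i) + n₀) = ∑ i, (n₀ * (a i * n i)) / (t - 2 * n i) := by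
  set M := (∑ i, (a i : ℝ) * n i) with hM
  have hn0 : (0:ℝ) < n₀ := by exact_mod_cast hn₀
  constructor
  · rintro ⟨x, hx, hS⟩
    set S := ∑ w, x w with hSdef
    have hc : ∀ v, (t - M) * x (Sum.inl v) = S := by
      intro v
      have := congrFun hx (Sum.inl v)
      rw [aux_core] at this
      simp only [Pi.smul_apply, smul_eq_mul] at this
      rw [← hM, ← hSdef] at this
      linarith
    have htM : t ≠ M := by
      intro h
      apply hS
      rw [← hc ⟨0, hn₀⟩, h]; ring
    have htM' : t - M ≠ 0 := sub_ne_zero.2 htM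
    set c := S / (t - M) with hcdef
    have hc0 : c ≠ 0 := div_ne_zero hS htM'
    have hxc : ∀ v, x (Sum.inl v) = c := by
      intro v; rw [hcdef, eq_div_iff htM', mul_comm, hc]
    have hS0 : ∑ w, x (Sum.inl w) = n₀ * c := by simp [hxc]
    have hC : ∀ i s, (t - 2 * n i) * (∑ u, x (Sum.inr ⟨i, s, u⟩)) = n i * (n₀ * c) := by
      intro i s
      have h : ∀ u, (t - n i) * x (Sum.inr ⟨i, s, u⟩) = (∑ u', x (Sum.inr ⟨i, s, u'⟩)) + n₀ * c := by
        intro u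
        have := congrFun hx (Sum.inr ⟨i, s, u⟩)
        rw [aux_sat, hS0] at this
        simp only [Pi.smul_apply, smul_eq_mul] at this
        linarith
      have h2 := Finset.sum_congr (rfl : (Finset.univ : Finset (Fin (n i))) = Finset.univ) (fun u _ => h u)
      rw [← Finset.mul_sum] at h2
      simp at h2
      linarith
    have hti : ∀ i, t ≠ 2 * n i := by
      intro i h
      have := hC i ⟨0, ha i⟩
      rw [h, sub_self, zero_mul] at this
      have h1 : (0:ℝ) < n i := by exact_mod_cast hn i
      exact (mul_ne_zero h1.ne' (mul_ne_zero hn0.ne' hc0)) this.symm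
    refine ⟨htM, hti, ?_⟩
    have hC' : ∀ i s, (∑ u, x (Sum.inr ⟨i, s, u⟩)) = n i * (n₀ * c) / (t - 2 * n i) := by
      intro i s
      rw [eq_div_iff (sub_ne_zero.2 (hti i)), mul_comm, hC]
    have hSS : S = n₀ * c + ∑ i, a i * (n i * (n₀ * c) / (t - 2 * n i)) := by
      rw [hSdef, Fintype.sum_sum_type, hS0, Fintype.sum_sigma]
      simp only [Fintype.sum_prod_type, hC']
      simp
    have hSc : S = (t - M) * c := by rw [hcdef]; field_simp
    have : (∑ i, a i * (n i * (n₀ * c) / (t - 2 * n i))) = c * ∑ i, (n₀ * (a i * n i)) / (t - 2 * n i) := by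
      rw [Finset.mul_sum]
      refine Finset.sum_congr rfl fun i _ => ?_
      ring
    rw [this, hSc] at hSS
    apply mul_left_cancel₀ hc0
    linarith
  · rintro ⟨htM, hti, he⟩
    let x : Fin n₀ ⊕ ((i : Fin p) × (Fin (a i) × Fin (n i))) → ℝ :=
      Sum.elim (fun _ => 1) (fun w => n₀ / (t - 2 * n w.1))
    have hS : ∑ w, x w = t - M := by
      rw [Fintype.sum_sum_type, Fintype.sum_sigma]
      simp only [x, Sum.elim_inl, Sum.elim_inr]
      simp
      have : ∑ i, (a i * n i : ℝ) * (n₀ / (t - 2 * n i)) = ∑ i, (n₀ * (a i * n i)) / (t - 2 * n i) :=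
        Finset.sum_congr rfl fun i _ => by ring
      rw [this, ← he]; ring
    refine ⟨x, ?_, ?_⟩
    · funext w
      rcases w with v | ⟨i, s, u⟩
      · rw [aux_core, hS, ← hM]
        simp [x]; ring
      · rw [aux_sat]
        have := sub_ne_zero.2 (hti i)
        have h3 : (n₀ : ℝ) / (t - 2 * n i) * (t - 2 * n i) = n₀ := div_mul_cancel₀ _ this
        simp only [x, Sum.elim_inl, Sum.elim_inr, Pi.smul_apply, smul_eq_mul, Finset.sum_const,
          Finset.card_univ, Fintype.card_fin, nsmul_eq_mul]
        linarith
    · rw [hS]; exact sub_ne_zero.2 htM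
end

/-- Arrowhead matrix. -/
noncomputable def arrowM (p : ℕ) (d w : Fin p → ℝ) (c : ℝ) :
    Matrix (Option (Fin p)) (Option (Fin p)) ℝ := fun x y =>
  match x, y with
  | none, none => c
  | none, some i => Real.sqrt (w i)
  | some i, none => Real.sqrt (w i)
  | some i, some j => if i = j then d i else 0

theorem arrow_none (p : ℕ) (d w : Fin p → ℝ) (c : ℝ) (x : Option (Fin p) → ℝ) :
    (arrowM p d w c).mulVec x none = c * x none + ∑ i, Real.sqrt (w i) * x (some i) := by
  simp [Matrix.mulVec, dotProduct, arrowM, Fintype.sum_option]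

theorem arrow_some (p : ℕ) (d w : Fin p → ℝ) (c : ℝ) (x : Option (Fin p) → ℝ) (i : Fin p) :
    (arrowM p d w c).mulVec x (some i) = Real.sqrt (w i) * x none + d i * x (some i) := by
  simp [Matrix.mulVec, dotProduct, arrowM, Fintype.sum_option]

theorem arrow_zero (p : ℕ) (d w : Fin p → ℝ) (c : ℝ) (hd : Function.Injective d)
    (hw : ∀ i, 0 < w i) (t : ℝ) (x : Option (Fin p) → ℝ)
    (hx : (arrowM p d w c).mulVec x = t • x) (h0 : x none = 0) : x = 0 := by
  have hs : ∀ i, d i * x (some i) = t * x (some i) := by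
    intro i
    have := congrFun hx (some i)
    rw [arrow_some, h0] at this
    simpa using this
  have hn := congrFun hx none
  rw [arrow_none] at hn
  simp [h0] at hn
  have key : ∀ i, x (some i) = 0 := by
    intro i
    by_contra hi
    have hti : d i = t := mul_right_cancel₀ hi (hs i)
    rw [Finset.sum_eq_single i] at hn
    · exact (mul_ne_zero (Real.sqrt_pos.2 (hw i)).ne' hi) hn
    · intro j _ hj
      have : x (some j) = 0 := by
        by_contra hxj
        exact hj (hd ((mul_right_cancel₀ hxj (hs j)).trans hti.symm))
      simp [this]
    · simp
  funext y
  cases y with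
  | none => exact h0
  | some i => exact key i

theorem arrow_iff (p : ℕ) (d w : Fin p → ℝ) (c : ℝ) (hd : Function.Injective d)
    (hw : ∀ i, 0 < w i) (t : ℝ) :
    (∃ x, x ≠ 0 ∧ (arrowM p d w c).mulVec x = t • x) ↔
      (∀ i, t ≠ d i) ∧ t - c = ∑ i, w i / (t - d i) := by
  constructor
  · rintro ⟨x, hx0, hx⟩
    have h0 : x none ≠ 0 := fun h => hx0 (arrow_zero p d w c hd hw t x hx h)
    have hs : ∀ i, (t - d i) * x (some i) = Real.sqrt (w i) * x none := by
      intro i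
      have := congrFun hx (some i)
      rw [arrow_some] at this
      simp only [Pi.smul_apply, smul_eq_mul] at this
      linarith
    have ht : ∀ i, t ≠ d i := by
      intro i h
      have := hs i
      rw [h, sub_self, zero_mul] at this
      exact mul_ne_zero (Real.sqrt_pos.2 (hw i)).ne' h0 this.symm
    refine ⟨ht, ?_⟩
    have hn := congrFun hx none
    rw [arrow_none] at hn
    simp only [Pi.smul_apply, smul_eq_mul] at hn
    have : ∑ i, Real.sqrt (w i) * x (some i) = (∑ i, w i / (t - d i)) * x none := by
      rw [Finset.sum_mul]
      refine Finset.sum_congr rfl fun i _ => ?_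
      have h1 := sub_ne_zero.2 (ht i)
      have h2 : x (some i) = Real.sqrt (w i) * x none / (t - d i) := by
        rw [eq_div_iff h1, mul_comm, hs]
      rw [h2]
      have h3 := Real.mul_self_sqrt (hw i).le
      field_simp
      rw [← h3]; ring_nf; simp [Real.sqrt_sq, Real.sqrt_nonneg]
    rw [this] at hn
    apply mul_right_cancel₀ h0
    linarith
  · rintro ⟨ht, he⟩
    refine ⟨fun y => y.elim 1 (fun i => Real.sqrt (w i) / (t - d i)), ?_, ?_⟩
    · intro h
      have := congrFun h none
      simp at this
    · funext y
      cases y with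
      | none =>
        rw [arrow_none]
        have : ∑ i, Real.sqrt (w i) * (Real.sqrt (w i) / (t - d i)) = t - c := by
          rw [he]
          refine Finset.sum_congr rfl fun i _ => ?_
          rw [← mul_div_assoc, Real.mul_self_sqrt (hw i).le]
        simp [this]
      | some i =>
        rw [arrow_some]
        have := sub_ne_zero.2 (ht i)
        simp
        field_simp
        ring

theorem secular_count (p : ℕ) (d w : Fin p → ℝ) (c : ℝ) (hd : Function.Injective d)
    (hw : ∀ i, 0 < w i) :
    {t : ℝ | (∀ i, t ≠ d i) ∧ t - c = ∑ i, w i / (t - d i)}.ncard = p + 1 := by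
  have hH : (arrowM p d w c).IsHermitian := by
    ext x y
    rcases x with _ | i <;> rcases y with _ | j <;> simp [arrowM]
    by_cases h : i = j
    · simp [h]
    · simp [h, Ne.symm h]
  have hinj : Function.Injective hH.eigenvalues := by
    intro j k hjk
    by_contra hne
    have hj := hH.mulVec_eigenvectorBasis j
    have hk := hH.mulVec_eigenvectorBasis k
    rw [← hjk] at hk
    set u := hH.eigenvectorBasis j with hu
    set v := hH.eigenvectorBasis k with hv
    have hz := arrow_zero p d w c hd hw (hH.eigenvalues j)
      ((v none) • (u : Option (Fin p) → ℝ) - (u none) • (v : Option (Fin p) → ℝ))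
      (by
        rw [Matrix.mulVec_sub, Matrix.mulVec_smul, Matrix.mulVec_smul, hj, hk]
        rw [smul_sub, smul_comm, smul_comm (u none)])
      (by simp [mul_comm])
    have hlin : (v none) • u - (u none) • v = 0 := by
      ext y
      have := congrFun hz y
      simpa using this
    have huv : inner ℝ v u = 0 := hH.eigenvectorBasis.orthonormal.2 (Ne.symm hne)
    have hvv : inner ℝ v v = (1:ℝ) := by
      rw [real_inner_self_eq_norm_sq, hH.eigenvectorBasis.orthonormal.1 k]; norm_num
    have h1 : inner ℝ v ((v none) • u - (u none) • v) = (0:ℝ) := by rw [hlin, inner_zero_right]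
    rw [inner_sub_right, inner_smul_right, inner_smul_right, huv, hvv] at h1
    have h2 : u none = 0 := by linarith
    have h3 := arrow_zero p d w c hd hw _ _ hj h2
    have h4 : u = 0 := by
      ext y
      exact congrFun h3 y
    have h5 := hH.eigenvectorBasis.orthonormal.1 j
    rw [← hu, h4, norm_zero] at h5
    exact zero_ne_one h5
  have hset : {t : ℝ | (∀ i, t ≠ d i) ∧ t - c = ∑ i, w i / (t - d i)} = Set.range hH.eigenvalues := by
    rw [← hH.spectrum_real_eq_range_eigenvalues]
    ext t
    rw [Set.mem_ofPred_eq, ← arrow_iff p d w c hd hw t]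
    rw [← Matrix.spectrum_toLin', ← Module.End.hasEigenvalue_iff_mem_spectrum]
    constructor
    · rintro ⟨x, hx0, hx⟩
      exact Module.End.hasEigenvalue_of_hasEigenvector
        (x := x) ⟨Module.End.mem_eigenspace_iff.2 (by simpa using hx), hx0⟩
    · intro h
      obtain ⟨x, hx⟩ := h.exists_hasEigenvector
      exact ⟨x, hx.2, by simpa using hx.apply_eq_smul⟩
  rw [hset, ← Set.image_univ, Set.ncard_image_of_injective _ hinj, Set.ncard_univ]
  simp


theorem nonroot (p : ℕ) (a n : Fin p → ℕ) (ha : ∀ i, 1 ≤ a i) (hn : ∀ i, 1 ≤ n i)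
    (h3 : 3 ≤ ∑ i, a i) (M : ℝ) (hM : M = ∑ i, (a i : ℝ) * n i) (hne : ∀ i, M ≠ 2 * n i)
    (h : ∑ i, (a i * n i : ℝ) / (M - 2 * n i) = -1) : False := by
  have ha' : ∀ i, (1:ℝ) ≤ a i := fun i => by exact_mod_cast ha i
  have hn' : ∀ i, (1:ℝ) ≤ n i := fun i => by exact_mod_cast hn i
  have han : ∀ i, (0:ℝ) < a i * n i := fun i => by
    have := ha' i; have := hn' i; positivity
  by_cases hall : ∀ i, 2 * (n i : ℝ) < M
  · have : 0 ≤ ∑ i, (a i * n i : ℝ) / (M - 2 * n i) :=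
      Finset.sum_nonneg fun i _ => div_nonneg (han i).le (by linarith [hall i])
    linarith
  push Not at hall
  obtain ⟨i, hi⟩ := hall
  have hi : M < 2 * n i := lt_of_le_of_ne hi (hne i)
  have hle : (a i * n i : ℝ) ≤ M := by
    rw [hM]
    exact Finset.single_le_sum (f := fun i => (a i * n i : ℝ)) (fun j _ => (han j).le) (Finset.mem_univ i)
  have hai : a i = 1 := by
    by_contra hc
    have h2 : 2 ≤ a i := by have := ha i; omega
    have h2' : (2:ℝ) ≤ a i := by exact_mod_cast h2
    nlinarith [hn' i]
  set s := Finset.univ.erase i with hs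
  set R := ∑ j ∈ s, (a j * n j : ℝ) with hR
  have hMR : M = n i + R := by
    rw [hM, ← Finset.add_sum_erase _ _ (Finset.mem_univ i), hai]; simp [hR, hs]
  have hA : (2:ℝ) ≤ ∑ j ∈ s, (a j : ℝ) := by
    have h4 := Finset.add_sum_erase Finset.univ a (Finset.mem_univ i)
    rw [hai] at h4
    have : 2 ≤ ∑ j ∈ s, a j := by rw [hs]; omega
    exact_mod_cast this
  have hj : ∀ j ∈ s, (n j : ℝ) + 1 ≤ R := by
    intro j hjs
    have h5 : (a j : ℝ) * (n j - 1) ≤ ∑ l ∈ s, (a l : ℝ) * (n l - 1) :=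
      Finset.single_le_sum (f := fun l => (a l : ℝ) * (n l - 1))
        (fun l _ => mul_nonneg (by linarith [ha' l]) (by linarith [hn' l])) hjs
    have h6 : R = ∑ l ∈ s, (a l : ℝ) * (n l - 1) + ∑ l ∈ s, (a l : ℝ) := by
      rw [hR, ← Finset.sum_add_distrib]
      exact Finset.sum_congr rfl fun l _ => by ring
    nlinarith [ha' j, hn' j]
  have hD : 0 < n i - R := by linarith
  have hsne : s.Nonempty := by
    by_contra hc
    rw [Finset.not_nonempty_iff_eq_empty] at hc
    rw [hc] at hA
    norm_num at hA
  have hlt : ∑ j ∈ s, (a j * n j : ℝ) / (M - 2 * n j) < ∑ j ∈ s, (a j * n j : ℝ) / (n i - R) := by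
    apply Finset.sum_lt_sum_of_nonempty hsne
    intro j hjs
    apply div_lt_div_of_pos_left (han j) hD
    linarith [hj j hjs]
  rw [← Finset.sum_div, ← hR] at hlt
  rw [← Finset.add_sum_erase _ _ (Finset.mem_univ i), ← hs, hai] at h
  have h7 : ((1:ℕ) * n i : ℝ) / (M - 2 * n i) = - (n i / (n i - R)) := by
    rw [hMR, ← div_neg]; congr 1 <;> push_cast <;> ring
  rw [h7] at h
  have h8 : (n i : ℝ) / (n i - R) - R / (n i - R) = 1 := by
    rw [← sub_div, div_self hD.ne']
  linarith

theorem count_eq (p n₀ : ℕ) (a n : Fin p → ℕ) (hn₀ : 1 ≤ n₀)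
    (ha : ∀ i, 1 ≤ a i) (hn : ∀ i, 1 ≤ n i) :
    mainQCount (graphJoin (⊤ : SimpleGraph (Fin n₀)) (satellites p a n)) =
      ({t : ℝ | (∀ i, t ≠ 2 * n i) ∧
        t - ((∑ i, (a i : ℝ) * n i) + n₀) = ∑ i, (n₀ * (a i * n i)) / (t - 2 * n i)} \
        {∑ i, (a i : ℝ) * n i}).ncard := by
  unfold mainQCount
  refine Eq.trans ?_ (Set.ncard_image_of_injective (f := fun t : ℝ => t + n₀ - 2) _
    (fun x y h => by simpa using h))
  congr 1
  ext q
  have hq := aux_main p n₀ a n hn₀ ha hn (q - n₀ + 2)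
  rw [show q - n₀ + 2 + n₀ - 2 = q by ring] at hq
  rw [Set.mem_ofPred_eq, hq]
  constructor
  · rintro ⟨h1, h2⟩
    exact ⟨q - n₀ + 2, ⟨h2, h1⟩, by ring⟩
  · rintro ⟨t, ⟨h2, h1⟩, rfl⟩
    rw [show t + n₀ - 2 - n₀ + 2 = t by ring]
    exact ⟨h1, h2⟩

theorem coreSatellite_k_main_iff
    (p n₀ : ℕ) (a n : Fin p → ℕ) (hp : 1 ≤ p) (hn₀ : 1 ≤ n₀)
    (ha : ∀ i, 1 ≤ a i) (hn : ∀ i, 1 ≤ n i) (hninj : Function.Injective n)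
    (k : ℕ) (hk : 3 ≤ k) :
    mainQCount (graphJoin (⊤ : SimpleGraph (Fin n₀)) (satellites p a n)) = k ↔
      (3 ≤ ∑ i, a i ∧ p = k - 1) := by
  rw [count_eq p n₀ a n hn₀ ha hn]
  have ha' : ∀ i, (1:ℝ) ≤ a i := fun i => by exact_mod_cast ha i
  have hn' : ∀ i, (1:ℝ) ≤ n i := fun i => by exact_mod_cast hn i
  have hn0 : (0:ℝ) < n₀ := by exact_mod_cast hn₀
  have hE := secular_count p (fun i => 2 * (n i : ℝ)) (fun i => n₀ * (a i * n i))
    ((∑ i, (a i : ℝ) * n i) + n₀)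
    (fun i j h => hninj (by simpa using h))
    (fun i => by have := ha' i; have := hn' i; positivity)
  set M := ∑ i, (a i : ℝ) * n i with hM
  set E := {t : ℝ | (∀ i, t ≠ 2 * n i) ∧
        t - (M + n₀) = ∑ i, (n₀ * (a i * n i)) / (t - 2 * n i)} with hEdef
  have hE : E.ncard = p + 1 := hE
  have hfin : E.Finite := Set.finite_of_ncard_ne_zero (by omega)
  have hsum : ∑ i, (n₀ * (a i * n i) : ℝ) / (M - 2 * n i)
      = n₀ * ∑ i, (a i * n i : ℝ) / (M - 2 * n i) := by
    rw [Finset.mul_sum]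
    exact Finset.sum_congr rfl fun i _ => by ring
  by_cases h3 : 3 ≤ ∑ i, a i
  · have hMn : M ∉ E := by
      rintro ⟨h1, h2⟩
      rw [hsum] at h2
      refine nonroot p a n ha hn h3 M hM h1 ?_
      apply mul_left_cancel₀ hn0.ne'
      linarith
    rw [Set.sdiff_singleton_eq_self hMn, hE]
    constructor
    · intro h; exact ⟨h3, by omega⟩
    · rintro ⟨_, h⟩; omega
  · have hp2 : p ≤ ∑ i, a i := by
      calc p = ∑ i : Fin p, 1 := by simp
        _ ≤ _ := Finset.sum_le_sum fun i _ => ha i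
    have hle2 : (E \ {M}).ncard ≤ 2 := by
      by_cases hp1 : p = 1
      · have := Set.ncard_le_ncard (Set.sdiff_subset (s := E) (t := {M})) hfin
        omega
      · have hpp : p = 2 := by omega
        subst hpp
        have h0 := ha 0
        have h1 := ha 1
        simp only [Fin.sum_univ_two] at h3 hM hsum
        have e0 : a 0 = 1 := by omega
        have e1 : a 1 = 1 := by omega
        have hd : (n 0 : ℝ) ≠ n 1 := fun h => by
          have := hninj (Nat.cast_injective h)
          exact absurd this (by decide)
        rw [e0, e1] at hM
        have hMm : M ∈ E := by
          refine ⟨?_, ?_⟩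
          · intro i
            rw [hM]
            fin_cases i
            · intro h
              apply hd
              simp at h
              linarith
            · intro h
              apply hd
              simp at h
              linarith
          · rw [Fin.sum_univ_two, hsum, e0, e1]
            have s1 : M - 2 * n 0 = -(n 0 - n 1) := by rw [hM]; push_cast; ring
            have s2 : M - 2 * n 1 = (n 0 - n 1) := by rw [hM]; push_cast; ring
            have s3 := sub_ne_zero.2 hd
            rw [s1, s2, div_neg]
            have s4 : (n 0 : ℝ) / (n 0 - n 1) - n 1 / (n 0 - n 1) = 1 := by
              rw [← sub_div, div_self s3]
            push_cast
            rw [one_mul, one_mul]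
            have s5 : -((n 0 : ℝ) / (n 0 - n 1)) + n 1 / (n 0 - n 1) = -1 := by linarith
            rw [s5]; ring
        have := Set.ncard_sdiff_singleton_add_one hMm hfin
        omega
    constructor
    · intro h; omega
    · rintro ⟨h, _⟩; exact absurd h h3
end

section
/- Let H be a finite simple graph, let p ≥ 1 be an integer, and let q be a nonzero real number. Then q is a main Q-eigenvalue of H if and only if q is a main Q-eigenvalue of the disjoint union K̄_p ∪ H. -/
open SimpleGraph

open Classical in
theorem signlessLaplacian_mulVec_apply {V : Type*} [Fintype V] (G : SimpleGraph V)
    (x : V → ℝ) (v : V) :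
    (signlessLaplacian G).mulVec x v = ∑ w, if G.Adj v w then x v + x w else 0 := by
  have hd : ((G.degree v : ℕ) : ℝ) = ∑ w, if G.Adj v w then (1 : ℝ) else 0 := by
    rw [← SimpleGraph.card_neighborFinset_eq_degree, SimpleGraph.neighborFinset_eq_filter]
    simp
  have h1 : (signlessLaplacian G).mulVec x v
      = (G.degree v : ℝ) * x v + (G.adjMatrix ℝ).mulVec x v := by
    unfold signlessLaplacian
    rw [Matrix.add_mulVec, Pi.add_apply, Matrix.mulVec_diagonal]
  rw [h1, hd, Finset.sum_mul]
  simp only [Matrix.mulVec, dotProduct, SimpleGraph.adjMatrix_apply]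
  rw [← Finset.sum_add_distrib]
  refine Finset.sum_congr rfl fun w _ => ?_
  split_ifs <;> simp

theorem union_mulVec_inl {W : Type*} [Fintype W] (H : SimpleGraph W) (p : ℕ)
    (x : Fin p ⊕ W → ℝ) (i : Fin p) :
    (signlessLaplacian (disjUnionGraph (⊥ : SimpleGraph (Fin p)) H)).mulVec x (Sum.inl i) = 0 := by
  rw [signlessLaplacian_mulVec_apply]
  simp [Fintype.sum_sum_type, disjUnionGraph]

theorem union_mulVec_inr {W : Type*} [Fintype W] (H : SimpleGraph W) (p : ℕ)
    (x : Fin p ⊕ W → ℝ) (w : W) :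
    (signlessLaplacian (disjUnionGraph (⊥ : SimpleGraph (Fin p)) H)).mulVec x (Sum.inr w)
      = (signlessLaplacian H).mulVec (fun w => x (Sum.inr w)) w := by
  rw [signlessLaplacian_mulVec_apply, signlessLaplacian_mulVec_apply]
  simp [Fintype.sum_sum_type, disjUnionGraph]
  refine Finset.sum_congr rfl fun u _ => ?_
  congr

theorem main_nonzero_iff_union_empty
    {W : Type*} [Fintype W] (H : SimpleGraph W) (p : ℕ) (hp : 1 ≤ p)
    (q : ℝ) (hq : q ≠ 0) :
    IsMainQEigenvalue H q ↔
      IsMainQEigenvalue (disjUnionGraph (⊥ : SimpleGraph (Fin p)) H) q := by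
  constructor
  · rintro ⟨x, hx, hs⟩
    refine ⟨Sum.elim (fun _ => 0) x, ?_, by simpa [Fintype.sum_sum_type] using hs⟩
    funext v
    rcases v with i | w
    · rw [union_mulVec_inl]; simp
    · rw [union_mulVec_inr]
      simpa using congrFun hx w
  · rintro ⟨x, hx, hs⟩
    have h0 : ∀ i, x (Sum.inl i) = 0 := by
      intro i
      have h := congrFun hx (Sum.inl i)
      rw [union_mulVec_inl] at h
      simpa [hq] using h.symm
    refine ⟨fun w => x (Sum.inr w), ?_, by simpa [Fintype.sum_sum_type, h0] using hs⟩
    funext w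
    have h := congrFun hx (Sum.inr w)
    rw [union_mulVec_inr] at h
    simpa using h
end
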